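/- arXiv:1506.00783 — 4 statements merged into one kernel-verified Lean document; each statement's English description precedes it below -/
import Mathlib

section
/- Let H be a real Hilbert space, q ∈ H∖{0}, and set u := q/‖q‖. For z_v, z_w ∈ H define D sc_q(z) := ‖q‖^{−1/2} z − (1/2) ‖q‖^{−5/2} ⟨z, q⟩ q. Then ⟨D sc_q(z_v), D sc_q(z_w)⟩ = ‖q‖^{−1} ( (1/4) ⟨z_v, u⟩ ⟨z_w, u⟩ + ⟨ z_v − ⟨z_v, u⟩ u , z_w − ⟨z_w, u⟩ u ⟩ ). Equivalently, ⟨D sc_q(z_v), D sc_q(z_w)⟩ = ‖q‖^{−1} ⟨z_v, z_w⟩ − (3/4) ‖q‖^{−3} ⟨z_v, q⟩ ⟨z_w, q⟩. -/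
open scoped RealInnerProductSpace

/-- Pointwise form of the elastic-metric formula: for `q ≠ 0` in a real Hilbert space,
`u = q/‖q‖`, and `D sc_q(z) = ‖q‖^{-1/2} z − (1/2)‖q‖^{-5/2}⟨z,q⟩q`, the inner product
`⟨D sc_q(z_v), D sc_q(z_w)⟩` equals both
`‖q‖⁻¹((1/4)⟨z_v,u⟩⟨z_w,u⟩ + ⟨z_v − ⟨z_v,u⟩u, z_w − ⟨z_w,u⟩u⟩)` and
`‖q‖⁻¹⟨z_v,z_w⟩ − (3/4)‖q‖⁻³⟨z_v,q⟩⟨z_w,q⟩`. -/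
theorem elastic_metric_pointwise {H : Type*} [NormedAddCommGroup H] [InnerProductSpace ℝ H]
    (q : H) (hq : q ≠ 0) (zv zw : H)
    (u : H) (hu : u = ‖q‖⁻¹ • q)
    (Dsc : H → H)
    (hDsc : ∀ z : H, Dsc z = (‖q‖ ^ (-(1:ℝ)/2)) • z
        - ((1/2) * ‖q‖ ^ (-(5:ℝ)/2) * ⟪z, q⟫) • q) :
    ⟪Dsc zv, Dsc zw⟫
        = ‖q‖⁻¹ * ((1/4) * (⟪zv, u⟫ * ⟪zw, u⟫)
            + ⟪zv - ⟪zv, u⟫ • u, zw - ⟪zw, u⟫ • u⟫) ∧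
    ⟪Dsc zv, Dsc zw⟫
        = ‖q‖⁻¹ * ⟪zv, zw⟫ - (3/4) * ‖q‖ ^ (-(3:ℝ)) * (⟪zv, q⟫ * ⟪zw, q⟫) := by
  have hn : 0 < ‖q‖ := norm_pos_iff.mpr hq
  have hs : ‖q‖ ^ (-(1:ℝ)/2) * ‖q‖ ^ (-(1:ℝ)/2) = ‖q‖⁻¹ := by
    rw [← Real.rpow_add hn, ← Real.rpow_neg_one]
    norm_num
  have ht : ‖q‖ ^ (-(5:ℝ)/2) = ‖q‖ ^ (-(1:ℝ)/2) * ‖q‖⁻¹ ^ 2 := by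
    rw [inv_pow, ← Real.rpow_natCast, ← Real.rpow_neg hn.le, ← Real.rpow_add hn]
    norm_num
  have h3 : ‖q‖ ^ (-(3:ℝ)) = ‖q‖⁻¹ ^ 3 := by
    rw [inv_pow, ← Real.rpow_natCast, ← Real.rpow_neg hn.le]
    norm_num
  have expand : ⟪Dsc zv, Dsc zw⟫
      = ‖q‖⁻¹ * ⟪zv, zw⟫ - (3/4) * ‖q‖ ^ (-(3:ℝ)) * (⟪zv, q⟫ * ⟪zw, q⟫) := by
    rw [hDsc, hDsc, ht, h3]
    simp only [inner_sub_left, inner_sub_right, real_inner_smul_left, real_inner_smul_right,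
      real_inner_self_eq_norm_sq, real_inner_comm zw q]
    generalize ‖q‖ ^ (-(1:ℝ)/2) = s at hs
    have hs' : s ^ 2 = ‖q‖⁻¹ := by rw [sq, hs]
    ring_nf
    rw [hs']
    field_simp
    ring
  refine ⟨?_, expand⟩
  rw [expand, h3, hu]
  simp only [inner_sub_left, inner_sub_right, real_inner_smul_left, real_inner_smul_right,
    real_inner_self_eq_norm_sq, real_inner_comm zw q]
  field_simp
  ring
end

section
/- Let A be a real unital Banach algebra, J ⊆ ℝ an open interval containing 0, and I = [0,1]. Let γ : J × I → A be a smooth map such that γ(ε, t) is invertible for all (ε, t), and set c(t) := γ(0, t) and v(t) := ∂_ε γ(ε, t)|_{ε=0}. Then for every t ∈ I, ∂_ε [ ∂_t γ(ε, t) · γ(ε, t)⁻¹ ] |_{ε=0} = d/dt ( v(t) · c(t)⁻¹ ) + [ v(t) · c(t)⁻¹ , ċ(t) · c(t)⁻¹ ], where [a, b] := a·b − b·a is the commutator bracket. -/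
open Set

/-- The derivative of `t ↦ (f t)⁻¹` in a Banach algebra. -/
theorem HasDerivWithinAt.ringInverse {A : Type*} [NormedRing A] [NormedAlgebra ℝ A]
    [CompleteSpace A] {f : ℝ → A} {f' : A} {s : Set ℝ} {x : ℝ}
    (hf : HasDerivWithinAt f f' s x) (hu : IsUnit (f x)) :
    HasDerivWithinAt (fun t => Ring.inverse (f t))
      (-(Ring.inverse (f x) * f' * Ring.inverse (f x))) s x := by
  obtain ⟨u, hu⟩ := hu
  have h := hasFDerivAt_ringInverse (𝕜 := ℝ) u
  rw [hu] at h
  have h2 := h.comp_hasDerivWithinAt x hf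
  rw [← hu, Ring.inverse_unit]
  simpa [Function.comp_def] using h2

/-- Tangent map of the right logarithmic derivative for linear Lie groups: if `γ : J × I → A`
is a smooth family of invertible elements of a real unital Banach algebra `A` (with `J` an open
interval around `0` and `I = [0,1]`), `c(t) = γ(0,t)` and `v(t) = ∂_ε γ(ε,t)|_{ε=0}`, then
`∂_ε[∂_t γ(ε,t) · γ(ε,t)⁻¹]|_{ε=0} = d/dt(v(t)c(t)⁻¹) + [v(t)c(t)⁻¹, ċ(t)c(t)⁻¹]`. -/
theorem tangent_map_right_log_deriv_linear {A : Type*} [NormedRing A] [NormedAlgebra ℝ A]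
    [CompleteSpace A]
    (J : Set ℝ) (hJ_open : IsOpen J) (hJ_conn : J.OrdConnected) (hJ0 : (0:ℝ) ∈ J)
    (γ : ℝ → ℝ → A)
    (hγ : ContDiffOn ℝ (⊤ : ℕ∞) (Function.uncurry γ) (J ×ˢ Icc (0:ℝ) 1))
    (hγ_unit : ∀ ε ∈ J, ∀ t ∈ Icc (0:ℝ) 1, IsUnit (γ ε t))
    (c : ℝ → A) (hc : ∀ t, c t = γ 0 t)
    (v : ℝ → A) (hv : ∀ t, v t = deriv (fun ε => γ ε t) 0) :
    ∀ t ∈ Icc (0:ℝ) 1,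
      deriv (fun ε => derivWithin (γ ε) (Icc (0:ℝ) 1) t * Ring.inverse (γ ε t)) 0
        = derivWithin (fun s => v s * Ring.inverse (c s)) (Icc (0:ℝ) 1) t
          + ((v t * Ring.inverse (c t)) * (derivWithin c (Icc (0:ℝ) 1) t * Ring.inverse (c t))
            - (derivWithin c (Icc (0:ℝ) 1) t * Ring.inverse (c t))
              * (v t * Ring.inverse (c t))) := by
  intro t ht
  set S : Set (ℝ × ℝ) := J ×ˢ Icc (0:ℝ) 1 with hS
  set D := fderivWithin ℝ (Function.uncurry γ) S with hD
  have hI : UniqueDiffOn ℝ (Icc (0:ℝ) 1) := uniqueDiffOn_Icc one_pos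
  have hSu : UniqueDiffOn ℝ S := hJ_open.uniqueDiffOn.prod hI
  have hF : ∀ p ∈ S, HasFDerivWithinAt (Function.uncurry γ) (D p) S p := fun p hp =>
    (hγ.differentiableOn (by simp) p hp).hasFDerivWithinAt
  have hpath : ∀ ε s, HasDerivWithinAt (fun r : ℝ => (ε, r)) ((0, 1) : ℝ × ℝ)
      (Icc (0:ℝ) 1) s := fun ε s =>
    (hasDerivWithinAt_const s _ ε).prodMk (hasDerivWithinAt_id s _)
  have hpath' : ∀ s ε, HasDerivWithinAt (fun e : ℝ => (e, s)) ((1, 0) : ℝ × ℝ) J ε := fun s ε =>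
    (hasDerivWithinAt_id ε _).prodMk (hasDerivWithinAt_const ε _ s)
  have hmt : ∀ ε ∈ J, MapsTo (fun r : ℝ => (ε, r)) (Icc (0:ℝ) 1) S := fun ε hε r hr => ⟨hε, hr⟩
  have hme : ∀ s ∈ Icc (0:ℝ) 1, MapsTo (fun e : ℝ => (e, s)) J S := fun s hs e he => ⟨he, hs⟩
  have ht' : ∀ ε ∈ J, ∀ s ∈ Icc (0:ℝ) 1,
      HasDerivWithinAt (γ ε) (D (ε, s) (0, 1)) (Icc (0:ℝ) 1) s := fun ε hε s hs =>
    (hF (ε, s) ⟨hε, hs⟩).comp_hasDerivWithinAt s (hpath ε s) (hmt ε hε)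
  have he' : ∀ ε ∈ J, ∀ s ∈ Icc (0:ℝ) 1,
      HasDerivWithinAt (fun e => γ e s) (D (ε, s) (1, 0)) J ε := fun ε hε s hs =>
    HasFDerivWithinAt.comp_hasDerivWithinAt (l := Function.uncurry γ) (f := fun e => (e, s)) ε
      (hF (ε, s) ⟨hε, hs⟩) (hpath' s ε) (hme s hs)
  have hJn : J ∈ nhds (0:ℝ) := hJ_open.mem_nhds hJ0
  have hv' : ∀ s ∈ Icc (0:ℝ) 1, v s = D (0, s) (1, 0) := fun s hs => by
    rw [hv, ((he' 0 hJ0 s hs).hasDerivAt hJn).deriv]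
  have hp : ((0, t) : ℝ × ℝ) ∈ S := ⟨hJ0, ht⟩
  set D2 := fderivWithin ℝ D S (0, t) with hD2
  have hDd : HasFDerivWithinAt D D2 S (0, t) :=
    ((hγ.fderivWithin (m := 1) hSu (WithTop.coe_le_coe.2 le_top)).differentiableOn
      (by simp) _ hp).hasFDerivWithinAt
  have hsymm : D2 (1, 0) (0, 1) = D2 (0, 1) (1, 0) := by
    have hcl : ((0, t) : ℝ × ℝ) ∈ closure (interior S) := by
      rw [hS, interior_prod_eq, closure_prod_eq, interior_Icc, closure_Ioo (by norm_num),
        hJ_open.interior_eq]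
      exact ⟨subset_closure hJ0, ht⟩
    exact (hγ (0, t) hp).isSymmSndFDerivWithinAt (by simpa using WithTop.coe_le_coe.2 (le_top : (2 : ℕ∞) ≤ ⊤)) hSu hcl hp _ _
  have hmix_e : HasDerivWithinAt (fun e => derivWithin (γ e) (Icc (0:ℝ) 1) t)
      (D2 (1, 0) (0, 1)) J 0 := by
    have h1 : HasDerivWithinAt (fun e => D (e, t)) (D2 (1, 0)) J 0 :=
      hDd.comp_hasDerivWithinAt (0:ℝ) (hpath' t 0) (hme t ht)
    have h2 := h1.clm_apply (hasDerivWithinAt_const (0:ℝ) J ((0, 1) : ℝ × ℝ))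
    simp only [map_zero, add_zero] at h2
    exact h2.congr_of_mem (fun e he => (ht' e he t ht).derivWithin (hI t ht)) hJ0
  have hmix_t : HasDerivWithinAt v (D2 (0, 1) (1, 0)) (Icc (0:ℝ) 1) t := by
    have h1 : HasDerivWithinAt (fun s => D (0, s)) (D2 (0, 1)) (Icc (0:ℝ) 1) t :=
      hDd.comp_hasDerivWithinAt t (hpath 0 t) (hmt 0 hJ0)
    have h2 := h1.clm_apply (hasDerivWithinAt_const t (Icc (0:ℝ) 1) ((1, 0) : ℝ × ℝ))
    simp only [map_zero, add_zero] at h2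
    exact h2.congr_of_mem hv' ht
  obtain rfl : c = γ 0 := funext hc
  have hu := hγ_unit 0 hJ0 t ht
  have hct := ht' 0 hJ0 t ht
  have hL := (hmix_e.mul ((he' 0 hJ0 t ht).ringInverse hu)).hasDerivAt hJn
  have hR := hmix_t.mul (hct.ringInverse hu)
  have hLd := hL.deriv
  have hRd := hR.derivWithin (hI t ht)
  simp only [Pi.mul_def] at hLd hRd
  rw [hLd, hRd, hct.derivWithin (hI t ht), hv' t ht, hsymm]
  noncomm_ring
end

section
/- Let 𝔤 be a finite-dimensional real inner product space with dim 𝔤 > 2, and let I = [0,1]. For all smooth curves q₁, q₂ : I → 𝔤∖{0} and every ε > 0 there exists a smooth curve v : I → 𝔤∖{0} such that sup_{t ∈ I} ‖v(t) − q₁(t)‖ < ε, and for all s ∈ [0,1] and t ∈ I both (1−s)·q₁(t) + s·v(t) ≠ 0 and (1−s)·v(t) + s·q₂(t) ≠ 0; that is, the two straight-line segments from q₁ to v and from v to q₂ stay pointwise in 𝔤∖{0}. -/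
open Set

/-- Approximation lemma in the proof that the geodesic distance equals the `L²`-distance:
for smooth nonvanishing curves `q₁, q₂ : [0,1] → 𝔤∖{0}` in a real inner product space with
`dim 𝔤 > 2`, and every `ε > 0`, there is a smooth nonvanishing curve `v`, uniformly
`ε`-close to `q₁`, such that the straight-line segments from `q₁` to `v` and from `v` to `q₂`
stay pointwise in `𝔤∖{0}`. -/
theorem exists_perturbation_linear_paths_nonvanishing {g : Type*} [NormedAddCommGroup g]
    [InnerProductSpace ℝ g] [FiniteDimensional ℝ g]
    (hdim : 2 < Module.finrank ℝ g)
    (q₁ q₂ : ℝ → g) (hq₁ : ContDiff ℝ (⊤ : ℕ∞) q₁) (hq₂ : ContDiff ℝ (⊤ : ℕ∞) q₂)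
    (hq₁0 : ∀ t ∈ Icc (0:ℝ) 1, q₁ t ≠ 0) (hq₂0 : ∀ t ∈ Icc (0:ℝ) 1, q₂ t ≠ 0)
    (ε : ℝ) (hε : 0 < ε) :
    ∃ v : ℝ → g, ContDiff ℝ (⊤ : ℕ∞) v ∧
      (∀ t ∈ Icc (0:ℝ) 1, v t ≠ 0) ∧
      (∀ t ∈ Icc (0:ℝ) 1, ‖v t - q₁ t‖ < ε) ∧
      (∀ s ∈ Icc (0:ℝ) 1, ∀ t ∈ Icc (0:ℝ) 1,
        (1 - s) • q₁ t + s • v t ≠ 0 ∧ (1 - s) • v t + s • q₂ t ≠ 0) := by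
  -- The obstruction to the second segment is swept out by a smooth two-parameter family.
  have hF : ContDiff ℝ 1 (fun p : ℝ × ℝ => -q₁ p.1 - p.2 • q₂ p.1) := by
    have h₁ : ContDiff ℝ 1 q₁ := hq₁.of_le (by exact_mod_cast le_top)
    have h₂ : ContDiff ℝ 1 q₂ := hq₂.of_le (by exact_mod_cast le_top)
    fun_prop
  have hdense := hF.dense_compl_range_of_finrank_lt_finrank (by simpa using hdim)
  obtain ⟨t₀, ht₀, hmin⟩ := isCompact_Icc.exists_isMinOn (nonempty_Icc.2 zero_le_one)
    (hq₁.continuous.norm.continuousOn (s := Icc (0:ℝ) 1))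
  have hδ : 0 < min ε ‖q₁ t₀‖ := lt_min hε (norm_pos_iff.2 (hq₁0 t₀ ht₀))
  obtain ⟨x, hx, hxδ⟩ := hdense.exists_dist_lt 0 hδ
  rw [dist_zero_left, lt_min_iff] at hxδ
  have hfirst : ∀ s ∈ Icc (0:ℝ) 1, ∀ t ∈ Icc (0:ℝ) 1, q₁ t + s • x ≠ 0 := by
    intro s hs t ht h
    have hnorm : ‖q₁ t‖ = s * ‖x‖ := by
      rw [eq_neg_of_add_eq_zero_left h, norm_neg, norm_smul, Real.norm_of_nonneg hs.1]
    have hle : ‖q₁ t₀‖ ≤ ‖q₁ t‖ := hmin ht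
    have hsx := mul_le_of_le_one_left (norm_nonneg x) hs.2
    linarith [hxδ.2]
  refine ⟨fun t => q₁ t + x, hq₁.add contDiff_const, fun t ht => ?_, fun t _ => ?_,
    fun s hs t ht => ⟨?_, fun h => ?_⟩⟩
  · simpa using hfirst 1 (right_mem_Icc.2 zero_le_one) t ht
  · simpa using hxδ.1
  · have h := hfirst s hs t ht
    rwa [show (1 - s) • q₁ t + s • (q₁ t + x) = q₁ t + s • x by module]
  · rcases eq_or_ne s 1 with rfl | hs1
    · exact hq₂0 t ht (by simpa using h)
    · have hs' : 1 - s ≠ 0 := sub_ne_zero.2 hs1.symm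
      refine hx ⟨(t, (1 - s)⁻¹ * s), ?_⟩
      have h' := congrArg (fun y => (1 - s)⁻¹ • y) h
      simp only [smul_add, smul_smul, inv_mul_cancel₀ hs', one_smul, smul_zero] at h'
      dsimp only
      rw [sub_eq_iff_eq_add, neg_eq_iff_add_eq_zero, ← h']
      abel
end

section
/- Let 𝔤 be a finite-dimensional real inner product space with dim 𝔤 > 2, and let I = [0,1]. For smooth curves p, q : I → 𝔤 set d_{L²}(p, q) := (∫_I ‖p(t) − q(t)‖² dt)^{1/2}. Call a finite sequence w₀, w₁, …, w_n of smooth curves I → 𝔤∖{0} an admissible chain from q₁ to q₂ if w₀ = q₁, w_n = q₂, and for every i ∈ {1,…,n}, every s ∈ [0,1] and every t ∈ I one has (1−s)·w_{i−1}(t) + s·w_i(t) ≠ 0. Then for all smooth q₁, q₂ : I → 𝔤∖{0}, the infimum of ∑_{i=1}^n d_{L²}(w_{i−1}, w_i) over all admissible chains from q₁ to q₂ equals d_{L²}(q₁, q₂). -/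
open Set

/-- The `L²` length of a continuous curve on `[0,1]`, as an `eLpNorm`. -/
theorem sqrt_integral_norm_sq_eq_toReal_eLpNorm {E : Type*} [NormedAddCommGroup E]
    {f : ℝ → E} (hf : Continuous f) :
    MeasureTheory.MemLp f 2 (MeasureTheory.volume.restrict (Icc (0:ℝ) 1)) ∧
    Real.sqrt (∫ t in Icc (0:ℝ) 1, ‖f t‖ ^ 2) =
      (MeasureTheory.eLpNorm f 2 (MeasureTheory.volume.restrict (Icc (0:ℝ) 1))).toReal := by
  have hmem : MeasureTheory.MemLp f 2 (MeasureTheory.volume.restrict (Icc (0:ℝ) 1)) := by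
    rw [MeasureTheory.memLp_two_iff_integrable_sq_norm hf.aestronglyMeasurable]
    exact (hf.norm.pow 2).integrableOn_Icc
  refine ⟨hmem, ?_⟩
  rw [hmem.eLpNorm_eq_integral_rpow_norm (by norm_num) (by norm_num),
    ENNReal.toReal_ofReal (by positivity), Real.sqrt_eq_rpow]
  norm_num

/-- The triangle inequality for the `L²` distance of continuous curves on `[0,1]`. -/
theorem sqrt_integral_norm_sub_sq_triangle {E : Type*} [NormedAddCommGroup E]
    {a b c : ℝ → E} (ha : Continuous a) (hb : Continuous b) (hc : Continuous c) :
    Real.sqrt (∫ t in Icc (0:ℝ) 1, ‖a t - c t‖ ^ 2) ≤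
      Real.sqrt (∫ t in Icc (0:ℝ) 1, ‖a t - b t‖ ^ 2) +
        Real.sqrt (∫ t in Icc (0:ℝ) 1, ‖b t - c t‖ ^ 2) := by
  obtain ⟨hab, eab⟩ := sqrt_integral_norm_sq_eq_toReal_eLpNorm (ha.sub hb)
  obtain ⟨hbc, ebc⟩ := sqrt_integral_norm_sq_eq_toReal_eLpNorm (hb.sub hc)
  obtain ⟨-, eac⟩ := sqrt_integral_norm_sq_eq_toReal_eLpNorm (ha.sub hc)
  simp only [Pi.sub_apply] at eab ebc eac
  rw [eab, ebc, eac, ← ENNReal.toReal_add hab.eLpNorm_ne_top hbc.eLpNorm_ne_top]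
  refine ENNReal.toReal_mono (ENNReal.add_ne_top.2 ⟨hab.eLpNorm_ne_top, hbc.eLpNorm_ne_top⟩) ?_
  rw [← sub_add_sub_cancel a b c]
  exact MeasureTheory.eLpNorm_add_le hab.1 hbc.1 (by norm_num)

/-- In dimension greater than two, arbitrarily small translations move the homotopy
`(s, t) ↦ (1 - s) • q₁ t + s • q₂ t` off the origin. -/
theorem exists_norm_lt_forall_segment_ne {g : Type*} [NormedAddCommGroup g]
    [InnerProductSpace ℝ g] [FiniteDimensional ℝ g] (hdim : 2 < Module.finrank ℝ g)
    {q₁ q₂ : ℝ → g} (hq₁ : ContDiff ℝ (⊤ : ℕ∞) q₁) (hq₂ : ContDiff ℝ (⊤ : ℕ∞) q₂)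
    {δ : ℝ} (hδ : 0 < δ) :
    ∃ v : g, ‖v‖ < δ ∧ ∀ s t : ℝ, (1 - s) • q₁ t + s • q₂ t ≠ v := by
  have hF : ContDiff ℝ 1 fun p : ℝ × ℝ => (1 - p.1) • q₁ p.2 + p.1 • q₂ p.2 := by
    have h₁ : ContDiff ℝ 1 q₁ := hq₁.of_le (by exact_mod_cast le_top)
    have h₂ : ContDiff ℝ 1 q₂ := hq₂.of_le (by exact_mod_cast le_top)
    fun_prop
  have hd := hF.dense_compl_range_of_finrank_lt_finrank (by simpa using hdim)
  obtain ⟨v, hv, hv'⟩ := hd.exists_dist_lt 0 hδ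
  exact ⟨v, by simpa using hv', fun s t h => hv ⟨(s, t), h⟩⟩

/-- A continuous curve not vanishing on `[0,1]` has norm bounded below there. -/
theorem exists_pos_forall_le_norm_of_ne_zero {E : Type*} [NormedAddCommGroup E]
    {q : ℝ → E} (hq : Continuous q) (hq0 : ∀ t ∈ Icc (0:ℝ) 1, q t ≠ 0) :
    ∃ δ > 0, ∀ t ∈ Icc (0:ℝ) 1, δ ≤ ‖q t‖ := by
  obtain ⟨t₀, ht₀, hmin⟩ := isCompact_Icc.exists_isMinOn
    (nonempty_Icc.2 zero_le_one) hq.norm.continuousOn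
  exact ⟨‖q t₀‖, norm_pos_iff.2 (hq0 t₀ ht₀), fun t ht => hmin ht⟩

/-- Vectors shorter than `x` cannot cancel `x`, even after scaling by `s ∈ [0,1]`. -/
theorem sub_smul_ne_zero_of_norm_lt {E : Type*} [NormedAddCommGroup E] [NormedSpace ℝ E]
    {x v : E} (h : ‖v‖ < ‖x‖) {s : ℝ} (hs : s ∈ Icc (0:ℝ) 1) : x - s • v ≠ 0 := by
  intro h0
  rw [sub_eq_zero.1 h0, norm_smul, Real.norm_of_nonneg hs.1] at h
  nlinarith [norm_nonneg v, hs.2]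

/-- Theorem 3.12 of the paper: if `dim 𝔤 > 2`, the geodesic distance on the space of smooth
nonvanishing curves `[0,1] → 𝔤∖{0}` — the infimum of the lengths
`∑ᵢ d_{L²}(w_{i−1}, w_i)` over all admissible chains, i.e. finite sequences of smooth
nonvanishing curves joining `q₁` to `q₂` whose consecutive straight-line segments stay
pointwise in `𝔤∖{0}` — is globally given by the `L²`-distance
`d_{L²}(q₁,q₂) = (∫ ‖q₁(t) − q₂(t)‖² dt)^{1/2}`. -/
theorem geodesic_distance_eq_L2 {g : Type*} [NormedAddCommGroup g]
    [InnerProductSpace ℝ g] [FiniteDimensional ℝ g]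
    (hdim : 2 < Module.finrank ℝ g)
    (q₁ q₂ : ℝ → g) (hq₁ : ContDiff ℝ (⊤ : ℕ∞) q₁) (hq₂ : ContDiff ℝ (⊤ : ℕ∞) q₂)
    (hq₁0 : ∀ t ∈ Icc (0:ℝ) 1, q₁ t ≠ 0) (hq₂0 : ∀ t ∈ Icc (0:ℝ) 1, q₂ t ≠ 0) :
    sInf { L : ℝ | ∃ (n : ℕ) (w : ℕ → ℝ → g),
        w 0 = q₁ ∧ w n = q₂ ∧
        (∀ i ≤ n, ContDiff ℝ (⊤ : ℕ∞) (w i) ∧ ∀ t ∈ Icc (0:ℝ) 1, w i t ≠ 0) ∧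
        (∀ i < n, ∀ s ∈ Icc (0:ℝ) 1, ∀ t ∈ Icc (0:ℝ) 1,
          (1 - s) • w i t + s • w (i + 1) t ≠ 0) ∧
        L = ∑ i ∈ Finset.range n,
              Real.sqrt (∫ t in Icc (0:ℝ) 1, ‖w i t - w (i + 1) t‖ ^ 2) }
      = Real.sqrt (∫ t in Icc (0:ℝ) 1, ‖q₁ t - q₂ t‖ ^ 2) := by
  have upper : ∀ ε > 0, ∃ (n : ℕ) (w : ℕ → ℝ → g),
      w 0 = q₁ ∧ w n = q₂ ∧
      (∀ i ≤ n, ContDiff ℝ (⊤ : ℕ∞) (w i) ∧ ∀ t ∈ Icc (0:ℝ) 1, w i t ≠ 0) ∧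
      (∀ i < n, ∀ s ∈ Icc (0:ℝ) 1, ∀ t ∈ Icc (0:ℝ) 1,
        (1 - s) • w i t + s • w (i + 1) t ≠ 0) ∧
      ∑ i ∈ Finset.range n, Real.sqrt (∫ t in Icc (0:ℝ) 1, ‖w i t - w (i + 1) t‖ ^ 2) <
        Real.sqrt (∫ t in Icc (0:ℝ) 1, ‖q₁ t - q₂ t‖ ^ 2) + ε := by
    intro ε hε
    obtain ⟨δ₁, hδ₁, h₁⟩ := exists_pos_forall_le_norm_of_ne_zero hq₁.continuous hq₁0
    obtain ⟨δ₂, hδ₂, h₂⟩ := exists_pos_forall_le_norm_of_ne_zero hq₂.continuous hq₂0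
    obtain ⟨v, hv, hseg⟩ := exists_norm_lt_forall_segment_ne hdim hq₁ hq₂
      (δ := min (ε / 2) (min δ₁ δ₂)) (by positivity)
    obtain ⟨hvε, hv₁, hv₂⟩ : ‖v‖ < ε / 2 ∧ ‖v‖ < δ₁ ∧ ‖v‖ < δ₂ := by
      simpa only [lt_min_iff] using hv
    let w : ℕ → ℝ → g
      | 0 => q₁
      | 1 => fun t => q₁ t - v
      | 2 => fun t => q₂ t - v
      | _ => q₂
    refine ⟨3, w, rfl, rfl, fun i hi => ?_, fun i hi s hs t ht => ?_, ?_⟩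
    · have hone : (1:ℝ) ∈ Icc (0:ℝ) 1 := by simp
      interval_cases i
      · exact ⟨hq₁, hq₁0⟩
      · exact ⟨hq₁.sub contDiff_const, fun t ht => by
          simpa [w] using sub_smul_ne_zero_of_norm_lt (hv₁.trans_le (h₁ t ht)) hone⟩
      · exact ⟨hq₂.sub contDiff_const, fun t ht => by
          simpa [w] using sub_smul_ne_zero_of_norm_lt (hv₂.trans_le (h₂ t ht)) hone⟩
      · exact ⟨hq₂, hq₂0⟩
    · interval_cases i
      · convert sub_smul_ne_zero_of_norm_lt (hv₁.trans_le (h₁ t ht)) hs using 1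
        simp only [w]
        module
      · convert sub_ne_zero.2 (hseg s t) using 1
        simp only [w]
        module
      · have hs' : 1 - s ∈ Icc (0:ℝ) 1 := ⟨by linarith [hs.2], by linarith [hs.1]⟩
        convert sub_smul_ne_zero_of_norm_lt (hv₂.trans_le (h₂ t ht)) hs' using 1
        simp only [w]
        module
    · simp only [Finset.sum_range_succ, Finset.sum_range_zero, w, sub_sub_cancel,
        sub_sub_sub_cancel_right, sub_sub_cancel_left, norm_neg]
      have hv' : Real.sqrt (∫ _ in Icc (0:ℝ) 1, ‖v‖ ^ 2) = ‖v‖ := by simp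
      rw [hv']
      linarith
  refine csInf_eq_of_forall_ge_of_forall_gt_exists_lt ?_ ?_ ?_
  · obtain ⟨n, w, h0, hn, hw, hs, -⟩ := upper 1 one_pos
    exact ⟨_, n, w, h0, hn, hw, hs, rfl⟩
  · rintro L ⟨n, w, rfl, rfl, hw, -, rfl⟩
    have key : ∀ k ≤ n, Real.sqrt (∫ t in Icc (0:ℝ) 1, ‖w 0 t - w k t‖ ^ 2) ≤
        ∑ i ∈ Finset.range k,
          Real.sqrt (∫ t in Icc (0:ℝ) 1, ‖w i t - w (i + 1) t‖ ^ 2) := by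
      intro k
      induction k with
      | zero => simp
      | succ k ih =>
        intro hk
        rw [Finset.sum_range_succ]
        exact (sqrt_integral_norm_sub_sq_triangle hq₁.continuous
          (hw k (by omega)).1.continuous (hw (k + 1) hk).1.continuous).trans
            (add_le_add_left (ih (by omega)) _)
    exact key n le_rfl
  · intro b hb
    obtain ⟨n, w, h0, hn, hw, hs, hL⟩ := upper _ (sub_pos.2 hb)
    exact ⟨_, ⟨n, w, h0, hn, hw, hs, rfl⟩, by linarith⟩
end
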